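/- Let Σ, C be F×F positive definite Hermitian matrices, λ ∈ (0,1), and define for a row vector r ∈ ℂ^{1×F}: Λ(r) = ((1−λ)/λ)(|Σ+C|/|C|) exp(−r(C^{-1} − (Σ+C)^{-1})r^H) and η(r) = r(Σ+C)^{-1}Σ / (1 + Λ(r)). Then the Jacobian of η satisfies η'(r) = (Σ+C)^{-1}Σ / (1+Λ(r)) + Λ(r) C^{-1} η(r)^H η(r), and there exists a constant K (depending only on Σ, C, λ, F) such that ‖η'(r)‖_F ≤ K for all r; consequently η is Lipschitz continuous. -/

import Mathlib

open MeasureTheory Matrix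
open scoped NNReal ComplexOrder

/-- Wirtinger derivative of `f : ℂ^F → ℂ` in the `i`-th coordinate:
`∂f/∂r_i = (1/2)(∂f/∂x_i − i ∂f/∂y_i)`. -/
noncomputable def wirt {F : ℕ} (f : (Fin F → ℂ) → ℂ) (r : Fin F → ℂ) (i : Fin F) : ℂ :=
  (1 / 2) * ((fderiv ℝ f r) (Pi.single i 1) - Complex.I * (fderiv ℝ f r) (Pi.single i Complex.I))

/-- Frobenius norm of a complex matrix. -/
noncomputable def frob {m n : Type*} [Fintype m] [Fintype n] (A : Matrix m n ℂ) : ℝ :=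
  Real.sqrt (∑ i, ∑ j, ‖A i j‖ ^ 2)

/-- A positive semidefinite matrix satisfies `‖A x‖² ≤ K · xᴴ A x`. -/
theorem Matrix.PosSemidef.exists_norm_mulVec_sq_le {n : Type*} [Fintype n] [DecidableEq n]
    {A : Matrix n n ℂ} (hA : A.PosSemidef) :
    ∃ K : ℝ, 0 ≤ K ∧ ∀ r : n → ℂ, ‖A *ᵥ star r‖ ^ 2 ≤ K * (r ⬝ᵥ (A *ᵥ star r)).re := by
  obtain ⟨D, rfl⟩ : ∃ D : Matrix n n ℂ, A = Dᴴ * D := by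
    open scoped MatrixOrder in
    exact CStarAlgebra.nonneg_iff_eq_star_mul_self.mp hA.nonneg
  let L := LinearMap.toContinuousLinearMap (Matrix.mulVecLin Dᴴ)
  refine ⟨‖L‖ ^ 2, by positivity, fun r => ?_⟩
  set u := D *ᵥ star r with hu
  have h1 : (Dᴴ * D) *ᵥ star r = L u := by
    simp [L, hu, Matrix.mulVec_mulVec]
  have h2 : (r ⬝ᵥ ((Dᴴ * D) *ᵥ star r)).re = ∑ k, ‖u k‖ ^ 2 := by
    have : r ⬝ᵥ ((Dᴴ * D) *ᵥ star r) = star u ⬝ᵥ u := by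
      rw [← Matrix.mulVec_mulVec, Matrix.dotProduct_mulVec, hu, Matrix.star_mulVec, star_star]
    rw [this, dotProduct, Complex.re_sum]
    refine Finset.sum_congr rfl fun k _ => ?_
    rw [Pi.star_apply, RCLike.star_def, Complex.conj_mul']
    norm_cast
  have h3 : ‖u‖ ^ 2 ≤ ∑ k, ‖u k‖ ^ 2 := by
    have h0 : 0 ≤ ∑ k, ‖u k‖ ^ 2 := by positivity
    have : ‖u‖ ≤ √(∑ k, ‖u k‖ ^ 2) := by
      refine (pi_norm_le_iff_of_nonneg (Real.sqrt_nonneg _)).2 fun k => ?_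
      exact Real.le_sqrt_of_sq_le
        (Finset.single_le_sum (f := fun k => ‖u k‖ ^ 2) (fun _ _ => by positivity)
          (Finset.mem_univ k))
    calc ‖u‖ ^ 2 ≤ √(∑ k, ‖u k‖ ^ 2) ^ 2 := by gcongr
      _ = _ := Real.sq_sqrt h0
  rw [h2, h1]
  calc ‖L u‖ ^ 2 ≤ (‖L‖ * ‖u‖) ^ 2 := by gcongr; exact L.le_opNorm u
    _ = ‖L‖ ^ 2 * ‖u‖ ^ 2 := by ring
    _ ≤ _ := by gcongr

/-- The real derivative of the real part of a Hermitian form `r ↦ r A rᴴ`. -/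
theorem Matrix.IsHermitian.exists_hasFDerivAt_re_dotProduct {n : Type*} [Fintype n]
    {A : Matrix n n ℂ} (hA : A.IsHermitian) (r : n → ℂ) :
    ∃ q' : (n → ℂ) →L[ℝ] ℝ,
      HasFDerivAt (fun s : n → ℂ => (s ⬝ᵥ (A *ᵥ star s)).re) q' r ∧
        ∀ h, q' h = 2 * (h ⬝ᵥ (A *ᵥ star r)).re := by
  let T : (n → ℂ) →L[ℝ] (n → ℂ) := LinearMap.toContinuousLinearMap
    { toFun := fun s => A *ᵥ star s
      map_add' := fun x y => by rw [star_add, Matrix.mulVec_add]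
      map_smul' := fun c x => by
        rw [star_smul, star_trivial, Matrix.mulVec_smul, RingHom.id_apply] }
  have hT : ∀ s, T s = A *ᵥ star s := fun s => rfl
  have hd := HasFDerivAt.fun_sum (u := Finset.univ) (x := r)
    fun (i : n) _ => ((ContinuousLinearMap.proj (R := ℝ) (φ := fun _ : n => ℂ) i).hasFDerivAt
      (x := r)).mul (((ContinuousLinearMap.proj (R := ℝ) (φ := fun _ : n => ℂ) i).comp
        T).hasFDerivAt (x := r))
  have hre := (Complex.reCLM.hasFDerivAt).comp r hd
  refine ⟨_, hre, fun h => ?_⟩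
  have hsymm : r ⬝ᵥ (A *ᵥ star h) = star (h ⬝ᵥ (A *ᵥ star r)) := by
    rw [← Matrix.star_dotProduct_star, Matrix.star_mulVec, star_star, hA.eq,
      ← Matrix.dotProduct_mulVec]
  have hval : (r ⬝ᵥ (A *ᵥ star h) + h ⬝ᵥ (A *ᵥ star r)).re
      = 2 * (h ⬝ᵥ (A *ᵥ star r)).re := by
    rw [hsymm, Complex.add_re, RCLike.star_def, Complex.conj_re]
    ring
  rw [← hval]
  simp [hT, dotProduct, Finset.sum_add_distrib, mul_comm]

/-- `C⁻¹ - (S + C)⁻¹` factors through `C⁻¹ S (S + C)⁻¹`. -/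
theorem Matrix.inv_sub_inv_add {n : Type*} [Fintype n] [DecidableEq n] {S C : Matrix n n ℂ}
    (hC : IsUnit C.det) (hM : IsUnit (S + C).det) :
    C⁻¹ - (S + C)⁻¹ = C⁻¹ * S * (S + C)⁻¹ := by
  have h : C⁻¹ * S * (S + C)⁻¹ = C⁻¹ * ((S + C) - C) * (S + C)⁻¹ := by
    rw [add_sub_cancel_right]
  rw [h, mul_sub, sub_mul, Matrix.nonsing_inv_mul _ hC, one_mul, mul_assoc,
    Matrix.mul_nonsing_inv _ hM, mul_one]

/-- `C⁻¹ - (S + C)⁻¹` factors through `(S + C)⁻¹ S C⁻¹`. -/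
theorem Matrix.inv_sub_inv_add' {n : Type*} [Fintype n] [DecidableEq n] {S C : Matrix n n ℂ}
    (hC : IsUnit C.det) (hM : IsUnit (S + C).det) :
    C⁻¹ - (S + C)⁻¹ = (S + C)⁻¹ * S * C⁻¹ := by
  have h : (S + C)⁻¹ * S * C⁻¹ = (S + C)⁻¹ * ((S + C) - C) * C⁻¹ := by
    rw [add_sub_cancel_right]
  rw [h, mul_sub, sub_mul, Matrix.nonsing_inv_mul _ hM, one_mul, mul_assoc,
    Matrix.mul_nonsing_inv _ hC, mul_one]

theorem Matrix.PosSemidef.inv_sub_inv_add {n : Type*} [Fintype n] [DecidableEq n]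
    {S C : Matrix n n ℂ} (hS : S.PosSemidef) (hC : C.PosDef) :
    (C⁻¹ - (S + C)⁻¹).PosSemidef := by
  have hM : (S + C).PosDef := Matrix.PosDef.posSemidef_add hS hC
  have hCu : IsUnit C.det := (Matrix.isUnit_iff_isUnit_det _).1 hC.isUnit
  have hMu : IsUnit (S + C).det := (Matrix.isUnit_iff_isUnit_det _).1 hM.isUnit
  have key : C⁻¹ - (S + C)⁻¹ = (S + C)⁻¹ * (S + S * C⁻¹ * S) * ((S + C)⁻¹)ᴴ := by
    have h1 : S + S * C⁻¹ * S = S * C⁻¹ * (S + C) := by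
      rw [mul_add, mul_assoc S C⁻¹ C, Matrix.nonsing_inv_mul _ hCu, mul_one, add_comm]
    rw [hM.isHermitian.inv.eq, h1, Matrix.inv_sub_inv_add' hCu hMu]
    simp only [mul_assoc, Matrix.mul_nonsing_inv _ hMu, mul_one]
  rw [key]
  refine Matrix.PosSemidef.mul_mul_conjTranspose_same (hS.add ?_) _
  have := hC.inv.posSemidef.mul_mul_conjTranspose_same S
  rwa [hS.isHermitian.eq] at this

theorem norm_dotProduct_le_card_mul {n : Type*} [Fintype n] (x y : n → ℂ) :
    ‖x ⬝ᵥ y‖ ≤ Fintype.card n * (‖x‖ * ‖y‖) := by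
  calc ‖x ⬝ᵥ y‖ ≤ ∑ i, ‖x i * y i‖ := norm_sum_le _ _
    _ ≤ ∑ _i : n, ‖x‖ * ‖y‖ := by
        gcongr with i
        rw [norm_mul]
        gcongr <;> exact norm_le_pi_norm _ i
    _ = _ := by simp

/-- Jacobian of the Bernoulli–Gaussian posterior-mean denoiser: with
`Λ(r) = ((1−λ)/λ)(|Σ+C|/|C|) exp(−r(C⁻¹−(Σ+C)⁻¹)rᴴ)` and
`η(r) = r(Σ+C)⁻¹Σ/(1+Λ(r))`, the Wirtinger Jacobian satisfies
`η'(r) = (Σ+C)⁻¹Σ/(1+Λ(r)) + Λ(r) C⁻¹ η(r)ᴴη(r)`, its Frobenius norm is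
uniformly bounded, and consequently `η` is Lipschitz. -/
theorem stmt9 (F : ℕ) (Sig Cm : Matrix (Fin F) (Fin F) ℂ)
    (hSig : Sig.PosSemidef) (hCm : Cm.PosDef)
    (lam : ℝ) (hlam : lam ∈ Set.Ioo (0:ℝ) 1)
    (Λ : (Fin F → ℂ) → ℝ)
    (hΛ : ∀ r, Λ r = ((1 - lam) / lam) * ((Sig + Cm).det.re / Cm.det.re)
        * Real.exp (-(r ⬝ᵥ ((Cm⁻¹ - (Sig + Cm)⁻¹) *ᵥ star r)).re))
    (η : (Fin F → ℂ) → (Fin F → ℂ))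
    (hη : ∀ r, η r = (1 + Λ r)⁻¹ • Matrix.vecMul r ((Sig + Cm)⁻¹ * Sig)) :
    (∀ r, (Matrix.of fun i j => wirt (fun s => η s j) r i)
        = (1 + Λ r)⁻¹ • ((Sig + Cm)⁻¹ * Sig)
          + (Λ r) • (Cm⁻¹ * Matrix.vecMulVec (star (η r)) (η r)))
    ∧ (∃ K : ℝ, ∀ r, frob ((Matrix.of fun i j => wirt (fun s => η s j) r i)) ≤ K)
    ∧ (∃ K' : ℝ≥0, LipschitzWith K' η) := by
  have hM : (Sig + Cm).PosDef := Matrix.PosDef.posSemidef_add hSig hCm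
  have hCu : IsUnit Cm.det := (Matrix.isUnit_iff_isUnit_det _).1 hCm.isUnit
  have hMu : IsUnit (Sig + Cm).det := (Matrix.isUnit_iff_isUnit_det _).1 hM.isUnit
  have hA := hSig.inv_sub_inv_add hCm
  have hA1 := Matrix.inv_sub_inv_add hCu hMu
  have hA2 := Matrix.inv_sub_inv_add' hCu hMu
  set A := Cm⁻¹ - (Sig + Cm)⁻¹
  set B := (Sig + Cm)⁻¹ * Sig with hB
  set c := ((1 - lam) / lam) * ((Sig + Cm).det.re / Cm.det.re)
  have hBA : B = A * Cm := by
    rw [hA2, mul_assoc, Matrix.nonsing_inv_mul _ hCu, mul_one]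
  have hCB : Cm⁻¹ * Bᴴ = A := by
    rw [hA1, hB, Matrix.conjTranspose_mul, hM.isHermitian.inv.eq, hSig.isHermitian.eq, mul_assoc]
  have hc0 : 0 ≤ c := by
    have h1 := (Complex.pos_iff.1 hM.det_pos).1
    have h2 := (Complex.pos_iff.1 hCm.det_pos).1
    have h3 := hlam.1
    have h4 : 0 < 1 - lam := sub_pos.2 hlam.2
    positivity
  have hΛ0 : ∀ r, 0 ≤ Λ r := fun r => by rw [hΛ]; positivity
  have hpos : ∀ r, 0 < 1 + Λ r := fun r => by linarith [hΛ0 r]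
  have hΛ' : Λ = fun r => c * Real.exp (-(r ⬝ᵥ (A *ᵥ star r)).re) := funext hΛ
  let V : (Fin F → ℂ) →L[ℝ] (Fin F → ℂ) :=
    (LinearMap.toContinuousLinearMap (Matrix.vecMulLinear B)).restrictScalars ℝ
  have hV : ∀ r, V r = r ᵥ* B := fun r => rfl
  have hderiv : ∀ r, ∃ η' : (Fin F → ℂ) →L[ℝ] (Fin F → ℂ), HasFDerivAt η η' r ∧
      ∀ h, η' h = (1 + Λ r)⁻¹ • (h ᵥ* B)
        + (2 * Λ r * (h ⬝ᵥ (A *ᵥ star r)).re / (1 + Λ r) ^ 2) • (r ᵥ* B) := by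
    intro r
    obtain ⟨q', hq', hq'v⟩ := hA.isHermitian.exists_hasFDerivAt_re_dotProduct r
    have h1 : HasFDerivAt Λ (c • (Real.exp (-(r ⬝ᵥ (A *ᵥ star r)).re) • -q')) r := by
      rw [hΛ']
      exact (hq'.neg.exp).const_mul c
    have h2 := (hasDerivAt_inv (hpos r).ne').comp_hasFDerivAt r (h1.const_add 1)
    have h3 := h2.smul (V.hasFDerivAt (x := r))
    have h4 : η = (fun s => (Inv.inv ∘ fun x => 1 + Λ x) s • V s) := funext hη
    rw [h4]
    refine ⟨_, h3, fun h => ?_⟩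
    have h5 : Λ r = c * Real.exp (-(r ⬝ᵥ (A *ᵥ star r)).re) := hΛ r
    simp only [_root_.add_apply, _root_.smul_apply,
      ContinuousLinearMap.smulRight_apply, _root_.neg_apply, hq'v, hV,
      Function.comp_apply, smul_eq_mul]
    congr 2
    rw [← mul_neg, ← mul_assoc c, ← h5]
    ring
  choose η' hη' hη'v using hderiv
  have hbound : ∃ K : ℝ, 0 ≤ K ∧ ∀ r, ‖η' r‖ ≤ K := by
    obtain ⟨K, hK, hKA⟩ := hA.exists_norm_mulVec_sq_le
    let W := LinearMap.toContinuousLinearMap (Matrix.vecMulLinear Cm)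
    refine ⟨‖V‖ + 2 * F * ‖W‖ * c * K, by positivity, fun r => ?_⟩
    refine ContinuousLinearMap.opNorm_le_bound _ (by positivity) fun h => ?_
    set t := ‖A *ᵥ star r‖ with ht
    set q := (r ⬝ᵥ (A *ᵥ star r)).re with hq
    have hrB : ‖r ᵥ* B‖ ≤ ‖W‖ * t := by
      have h1 : r ᵥ* B = W (star (A *ᵥ star r)) := by
        rw [Matrix.star_mulVec, star_star, hA.isHermitian.eq, hBA, ← Matrix.vecMul_vecMul]
        rfl
      rw [h1, ht, ← norm_star (A *ᵥ star r)]
      exact W.le_opNorm _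
    have hdot : |(h ⬝ᵥ (A *ᵥ star r)).re| ≤ F * (‖h‖ * t) := by
      refine (Complex.abs_re_le_norm _).trans ?_
      simpa using norm_dotProduct_le_card_mul h (A *ᵥ star r)
    have hexp : Λ r * t ^ 2 ≤ c * K := by
      have h1 : q * Real.exp (-q) ≤ 1 := by
        rw [Real.exp_neg, ← div_eq_mul_inv, div_le_one (Real.exp_pos _)]
        linarith [Real.add_one_le_exp q]
      calc Λ r * t ^ 2 ≤ Λ r * (K * q) := by gcongr; exacts [hΛ0 r, hKA r]
        _ = c * K * (q * Real.exp (-q)) := by rw [hΛ r]; ring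
        _ ≤ c * K * 1 := by gcongr
        _ = c * K := mul_one _
    have hinv : (1 + Λ r)⁻¹ ≤ 1 := inv_le_one_of_one_le₀ (by linarith [hΛ0 r])
    have hone : 1 ≤ (1 + Λ r) ^ 2 := one_le_pow₀ (by linarith [hΛ0 r])
    rw [hη'v, add_mul]
    refine (norm_add_le _ _).trans (add_le_add ?_ ?_)
    · rw [norm_smul, Real.norm_of_nonneg (inv_nonneg.2 (hpos r).le)]
      calc (1 + Λ r)⁻¹ * ‖h ᵥ* B‖ ≤ 1 * (‖V‖ * ‖h‖) := by
            gcongr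
            exact V.le_opNorm h
        _ = _ := one_mul _
    · rw [norm_smul, Real.norm_eq_abs, abs_div, abs_mul, abs_mul, abs_two,
        abs_of_nonneg (hΛ0 r), abs_of_nonneg (zero_le_one.trans hone)]
      have hΛr := hΛ0 r
      calc 2 * Λ r * |(h ⬝ᵥ (A *ᵥ star r)).re| / (1 + Λ r) ^ 2 * ‖r ᵥ* B‖
          ≤ 2 * Λ r * |(h ⬝ᵥ (A *ᵥ star r)).re| * ‖r ᵥ* B‖ := by
            gcongr
            exact div_le_self (by positivity) hone
        _ ≤ 2 * Λ r * (F * (‖h‖ * t)) * (‖W‖ * t) := by gcongr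
        _ = 2 * F * ‖W‖ * ‖h‖ * (Λ r * t ^ 2) := by ring
        _ ≤ 2 * F * ‖W‖ * ‖h‖ * (c * K) := by gcongr
        _ = _ := by ring
  have hwirt : ∀ r i j, wirt (fun s => η s j) r i = (1 / 2) *
      (η' r (Pi.single i 1) j - Complex.I * η' r (Pi.single i Complex.I) j) := by
    intro r i j
    rw [wirt, (hasFDerivAt_pi'.1 (hη' r) j).fderiv]
    rfl
  obtain ⟨K, hK0, hK⟩ := hbound
  refine ⟨fun r => ?_, ⟨√(∑ _i : Fin F, ∑ _j : Fin F, K ^ 2), fun r => ?_⟩, K.toNNReal, ?_⟩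
  · ext i j
    have h0 : ((1 + Λ r : ℝ) : ℂ) ≠ 0 := Complex.ofReal_ne_zero.2 (hpos r).ne'
    have h1 : (Cm⁻¹ * Matrix.vecMulVec (star (η r)) (η r)) i j
        = (((1 + Λ r : ℝ) : ℂ)⁻¹) ^ 2 * ((A *ᵥ star r) i * (r ᵥ* B) j) := by
      have h2 : Cm⁻¹ *ᵥ star (η r) = (1 + Λ r)⁻¹ • (A *ᵥ star r) := by
        rw [hη, star_smul, star_trivial, Matrix.mulVec_smul, Matrix.star_vecMul,
          Matrix.mulVec_mulVec, hCB]
      rw [Matrix.mul_vecMulVec, Matrix.vecMulVec_apply, h2, hη]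
      simp only [Pi.smul_apply, Complex.real_smul, Complex.ofReal_inv]
      ring
    rw [Matrix.of_apply, hwirt, hη'v, hη'v, Matrix.add_apply, Matrix.smul_apply,
      Matrix.smul_apply, h1]
    set w := A *ᵥ star r
    have hw : w i = ((w i).re : ℂ) + (w i).im * Complex.I := (Complex.re_add_im _).symm
    have hI : (Pi.single i Complex.I : Fin F → ℂ) ᵥ* B = Complex.I • B i := by
      rw [Matrix.single_vecMul]; rfl
    have h1' : (Pi.single i 1 : Fin F → ℂ) ᵥ* B = B i := by
      rw [Matrix.single_one_vecMul]; rfl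
    rw [hI, h1', single_dotProduct, single_dotProduct]
    simp only [Pi.add_apply, Pi.smul_apply, Complex.real_smul, smul_eq_mul, one_mul,
      Complex.I_mul_re]
    simp
    push_cast at h0
    field_simp
    ring_nf
    simp only [Complex.I_sq]
    linear_combination (-2 * (Λ r : ℂ) * (r ᵥ* B) j) * hw
  · refine Real.sqrt_le_sqrt (Finset.sum_le_sum fun i _ => Finset.sum_le_sum fun j _ => ?_)
    rw [Matrix.of_apply, hwirt]
    have hle : ∀ z : ℂ, ‖z‖ = 1 → ‖η' r (Pi.single i z) j‖ ≤ K := fun z hz => by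
      calc ‖η' r (Pi.single i z) j‖ ≤ ‖η' r (Pi.single i z)‖ := norm_le_pi_norm _ j
        _ ≤ ‖η' r‖ * ‖(Pi.single i z : Fin F → ℂ)‖ := (η' r).le_opNorm _
        _ = ‖η' r‖ := by rw [Pi.norm_single, hz, mul_one]
        _ ≤ K := hK r
    gcongr
    have h1 := hle 1 norm_one
    have h2 := hle Complex.I Complex.norm_I
    have h3 := norm_sub_le (η' r (Pi.single i 1) j) (Complex.I * η' r (Pi.single i Complex.I) j)
    rw [norm_mul, Complex.norm_I, one_mul] at h3
    rw [norm_mul]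
    norm_num
    linarith
  · refine lipschitzWith_of_nnnorm_fderiv_le (𝕜 := ℝ) (fun r => (hη' r).differentiableAt)
      fun r => ?_
    rw [(hη' r).fderiv, ← NNReal.coe_le_coe, coe_nnnorm, Real.coe_toNNReal _ hK0]
    exact hK r
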